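/- arXiv:1604.02603 — 5 statements merged into one kernel-verified Lean document; each statement's English description precedes it below -/
import Mathlib

section
/- Let (S, Act, T) be a labelled transition system that is image-finite, i.e. for every state s and action a the set {t : s →a t} is finite. Then two states s, t ∈ S are bisimilar if and only if they satisfy exactly the same formulas of Hennessy–Milner logic. -/
/-- Hennessy–Milner logic formulas: `tt`, negation, conjunction, and the diamond
modality `⟨a⟩φ` for each action `a`. -/
inductive HML (Act : Type*) where
  | tt : HML Act
  | neg : HML Act → HML Act
  | and : HML Act → HML Act → HML Act
  | dia : Act → HML Act → HML Act

/-- Satisfaction of a Hennessy–Milner formula at a state of the labelled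
transition system `T`. -/
def HMLSat {S Act : Type*} (T : S → Act → S → Prop) : S → HML Act → Prop
  | _, .tt => True
  | s, .neg φ => ¬ HMLSat T s φ
  | s, .and φ ψ => HMLSat T s φ ∧ HMLSat T s ψ
  | s, .dia a φ => ∃ t, T s a t ∧ HMLSat T t φ

/-- `R` is a bisimulation on the labelled transition system `T`. -/
def IsBisimulation {S Act : Type*} (T : S → Act → S → Prop) (R : S → S → Prop) : Prop :=
  ∀ s t, R s t →
    (∀ a s', T s a s' → ∃ t', T t a t' ∧ R s' t') ∧
    (∀ a t', T t a t' → ∃ s', T s a s' ∧ R s' t')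

/-- Two states are bisimilar if they are related by some bisimulation. -/
def Bisimilar {S Act : Type*} (T : S → Act → S → Prop) (s t : S) : Prop :=
  ∃ R, IsBisimulation T R ∧ R s t

/-- Bisimulations preserve satisfaction of Hennessy–Milner formulas. -/
theorem IsBisimulation.hmlSat_iff {S Act : Type*} {T : S → Act → S → Prop} {R : S → S → Prop}
    (hR : IsBisimulation T R) (φ : HML Act) {s t : S} (hst : R s t) :
    HMLSat T s φ ↔ HMLSat T t φ := by
  induction φ generalizing s t with
  | tt => simp only [HMLSat]
  | neg φ ih => simp only [HMLSat, ih hst]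
  | and φ ψ ihφ ihψ => simp only [HMLSat, ihφ hst, ihψ hst]
  | dia a φ ih =>
    simp only [HMLSat]
    constructor
    · rintro ⟨s', hs', hφ⟩
      obtain ⟨t', ht', h⟩ := (hR s t hst).1 a s' hs'
      exact ⟨t', ht', (ih h).1 hφ⟩
    · rintro ⟨t', ht', hφ⟩
      obtain ⟨s', hs', h⟩ := (hR s t hst).2 a t' ht'
      exact ⟨s', hs', (ih h).2 hφ⟩

/-- Two states that do not satisfy the same formulas are separated by a formula that holds at the
first one. -/
theorem exists_hmlSat_and_not_hmlSat {S Act : Type*} {T : S → Act → S → Prop} {s t : S}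
    (h : ¬ ∀ φ : HML Act, (HMLSat T s φ ↔ HMLSat T t φ)) :
    ∃ φ : HML Act, HMLSat T s φ ∧ ¬ HMLSat T t φ := by
  obtain ⟨φ, hφ⟩ := not_forall.1 h
  by_cases hs : HMLSat T s φ
  · exact ⟨φ, hs, fun ht => hφ ⟨fun _ => ht, fun _ => hs⟩⟩
  · refine ⟨.neg φ, hs, fun ht : ¬ HMLSat T t φ => hφ ?_⟩
    exact ⟨fun h => absurd h hs, fun h => absurd h ht⟩

/-- A single formula separates a state from all members of a finite set of states none of which
satisfies the same formulas. -/
theorem exists_hmlSat_forall_not_hmlSat {S Act : Type*} {T : S → Act → S → Prop} {s : S}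
    {A : Set S} (hA : A.Finite)
    (h : ∀ t ∈ A, ¬ ∀ φ : HML Act, (HMLSat T s φ ↔ HMLSat T t φ)) :
    ∃ φ : HML Act, HMLSat T s φ ∧ ∀ t ∈ A, ¬ HMLSat T t φ := by
  induction A, hA using Set.Finite.induction_on with
  | empty => exact ⟨.tt, trivial, fun t ht => ht.elim⟩
  | @insert u B _ _ ih =>
    obtain ⟨φ, hsφ, hφ⟩ := ih fun t ht => h t (Set.mem_insert_of_mem u ht)
    obtain ⟨ψ, hsψ, hψ⟩ := exists_hmlSat_and_not_hmlSat (h u (Set.mem_insert u B))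
    refine ⟨.and φ ψ, ⟨hsφ, hsψ⟩, ?_⟩
    rintro t (rfl | ht) ⟨htφ, htψ⟩
    · exact hψ htψ
    · exact hφ t ht htφ

/-- If `s` and `t` satisfy the same formulas and `t` has finitely many `a`-successors, then every
`a`-successor of `s` satisfies the same formulas as some `a`-successor of `t`. -/
theorem exists_step_hml_equiv {S Act : Type*} {T : S → Act → S → Prop} {s t s' : S} {a : Act}
    (hfin : Set.Finite {t' | T t a t'})
    (hst : ∀ φ : HML Act, (HMLSat T s φ ↔ HMLSat T t φ)) (hs' : T s a s') :
    ∃ t', T t a t' ∧ ∀ φ : HML Act, (HMLSat T s' φ ↔ HMLSat T t' φ) := by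
  by_contra hne
  obtain ⟨φ, hφ, hnot⟩ := exists_hmlSat_forall_not_hmlSat hfin
    fun t' ht' heq => hne ⟨t', ht', heq⟩
  obtain ⟨t', ht', htφ⟩ := (hst (.dia a φ)).1 ⟨s', hs', hφ⟩
  exact hnot t' ht' htφ

/-- In an image-finite labelled transition system, satisfying the same formulas is a
bisimulation. -/
theorem isBisimulation_hml_equiv {S Act : Type*} {T : S → Act → S → Prop}
    (himagefinite : ∀ s a, Set.Finite {t | T s a t}) :
    IsBisimulation T fun s t => ∀ φ : HML Act, (HMLSat T s φ ↔ HMLSat T t φ) := by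
  refine fun s t hst => ⟨fun a s' => exists_step_hml_equiv (himagefinite t a) hst,
    fun a t' ht' => ?_⟩
  obtain ⟨s', hs', h⟩ := exists_step_hml_equiv (himagefinite s a) (fun φ => (hst φ).symm) ht'
  exact ⟨s', hs', fun φ => (h φ).symm⟩

/-- **Hennessy–Milner theorem.** In an image-finite labelled transition system,
two states are bisimilar iff they satisfy exactly the same formulas of
Hennessy–Milner logic. -/
theorem bisimilar_iff_hml_equiv {S Act : Type*} (T : S → Act → S → Prop)
    (himagefinite : ∀ s a, Set.Finite {t | T s a t}) (s t : S) :
    Bisimilar T s t ↔ ∀ φ : HML Act, (HMLSat T s φ ↔ HMLSat T t φ) := by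
  constructor
  · rintro ⟨R, hR, hst⟩ φ
    exact hR.hmlSat_iff φ hst
  · exact fun h => ⟨_, isBisimulation_hml_equiv himagefinite, h⟩
end

section
/- For every n ≥ 2, the Bayesian order ⊑ on the simplex Δⁿ of classical states is a partial order (reflexive, transitive, antisymmetric); its least element is the uniform distribution ⊥ = (1/n, …, 1/n), and its maximal elements are exactly the pure states e_1, …, e_n (where e_i assigns probability 1 to coordinate i). -/
/-- `x` is a classical `n`-state: a point of the simplex
`Δⁿ = {x ∈ [0,1]ⁿ : Σᵢ xᵢ = 1}`. -/
def IsClassicalState (n : ℕ) (x : Fin n → ℝ) : Prop :=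
  (∀ i, x i ∈ Set.Icc (0 : ℝ) 1) ∧ ∑ i, x i = 1

/-- The Bayesian projection `pᵢ : Δ^{n+1} ⇀ Δⁿ`: remove coordinate `i` and
renormalize.  (It is intended to be applied only when `x i ≠ 1`.) -/
noncomputable def bayesProj {n : ℕ} (i : Fin (n + 1)) (x : Fin (n + 1) → ℝ) : Fin n → ℝ :=
  fun j => (1 - x i)⁻¹ * x (i.succAbove j)

/-- The Bayesian order on classical states, defined inductively: on `Δ²`,
`x ⊑ y` iff `(y₁ ≤ x₁ ≤ 1/2)` or `(1/2 ≤ x₁ ≤ y₁)`; on `Δ^{n+1}` (`n ≥ 2`),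
`x ⊑ y` iff `pᵢ x ⊑ pᵢ y` whenever both projections are defined. -/
def BayesLE : (n : ℕ) → (Fin n → ℝ) → (Fin n → ℝ) → Prop
  | 0, _, _ => True
  | 1, _, _ => True
  | 2, x, y => (y 0 ≤ x 0 ∧ x 0 ≤ 1 / 2) ∨ (1 / 2 ≤ x 0 ∧ x 0 ≤ y 0)
  | n + 3, x, y =>
      ∀ i : Fin (n + 3), x i ≠ 1 → y i ≠ 1 →
        BayesLE (n + 2) (bayesProj i x) (bayesProj i y)

theorem IsClassicalState.eq_zero_of_eq_one {n : ℕ} {x : Fin n → ℝ} (hx : IsClassicalState n x)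
    {i j : Fin n} (hi : x i = 1) (hj : j ≠ i) : x j = 0 := by
  have h := Finset.add_le_sum (fun k _ => (hx.1 k).1) (Finset.mem_univ i) (Finset.mem_univ j) hj.symm
  rw [hx.2, hi] at h
  linarith [(hx.1 j).1]

theorem IsClassicalState.eq_one_of_forall_eq_zero {n : ℕ} {x : Fin n → ℝ}
    (hx : IsClassicalState n x) {i : Fin n} (h : ∀ j, j ≠ i → x j = 0) : x i = 1 := by
  rw [← hx.2]
  exact (Finset.sum_eq_single i (fun j _ hj => h j hj) (by simp)).symm

theorem IsClassicalState.ext_of_eq_one {n : ℕ} {x y : Fin n → ℝ} (hx : IsClassicalState n x)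
    (hy : IsClassicalState n y) {i : Fin n} (hxi : x i = 1) (hyi : y i = 1) : x = y := by
  funext j
  by_cases hj : j = i
  · rw [hj, hxi, hyi]
  · rw [hx.eq_zero_of_eq_one hxi hj, hy.eq_zero_of_eq_one hyi hj]

theorem isClassicalState_single {n : ℕ} (i : Fin n) : IsClassicalState n (Pi.single i 1) := by
  refine ⟨fun j => ?_, by simp⟩
  by_cases hj : j = i
  · subst hj; simp
  · simp [hj]

theorem isClassicalState_uniform {n : ℕ} (hn : n ≠ 0) :
    IsClassicalState n (fun _ => (n : ℝ)⁻¹) :=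
  ⟨fun _ => ⟨by positivity, Nat.cast_inv_le_one n⟩, by simp [hn]⟩

theorem IsClassicalState.bayesProj {n : ℕ} {x : Fin (n + 1) → ℝ}
    (hx : IsClassicalState (n + 1) x) {i : Fin (n + 1)} (hi : x i ≠ 1) :
    IsClassicalState n (bayesProj i x) := by
  have hpos : 0 < 1 - x i := sub_pos.2 (lt_of_le_of_ne (hx.1 i).2 hi)
  have hsum : ∑ j, _root_.bayesProj i x j = 1 := by
    have h := hx.2
    rw [Fin.sum_univ_succAbove _ i] at h
    simp only [_root_.bayesProj, ← Finset.mul_sum]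
    rw [eq_sub_of_add_eq' h, inv_mul_cancel₀ hpos.ne']
  have hnonneg : ∀ j, 0 ≤ _root_.bayesProj i x j := fun j =>
    mul_nonneg (inv_nonneg.2 hpos.le) (hx.1 _).1
  refine ⟨fun j => ⟨hnonneg j, ?_⟩, hsum⟩
  rw [← hsum]
  exact Finset.single_le_sum (fun k _ => hnonneg k) (Finset.mem_univ j)

theorem bayesProj_uniform {n : ℕ} (hn : n ≠ 0) (i : Fin (n + 1)) :
    bayesProj i (fun _ => ((n + 1 : ℕ) : ℝ)⁻¹) = fun _ => (n : ℝ)⁻¹ := by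
  funext j
  have : (n : ℝ) ≠ 0 := Nat.cast_ne_zero.2 hn
  have h : (1 : ℝ) - ((n + 1 : ℕ) : ℝ)⁻¹ = n * ((n + 1 : ℕ) : ℝ)⁻¹ := by
    push_cast
    field_simp
    ring
  have h' : ((n + 1 : ℕ) : ℝ) ≠ 0 := Nat.cast_ne_zero.2 n.succ_ne_zero
  simp only [bayesProj, h]
  field_simp

theorem bayesLE_refl (m : ℕ) (x : Fin (m + 2) → ℝ) : BayesLE (m + 2) x x := by
  induction m with
  | zero => exact (le_total (x 0) (1 / 2)).imp (⟨le_rfl, ·⟩) (⟨·, le_rfl⟩)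
  | succ m ih => exact fun i _ _ => ih _

theorem uniform_bayesLE (m : ℕ) (x : Fin (m + 2) → ℝ) :
    BayesLE (m + 2) (fun _ => ((m + 2 : ℕ) : ℝ)⁻¹) x := by
  induction m with
  | zero =>
    simp only [BayesLE]
    norm_num
    exact le_total _ _
  | succ m ih =>
    intro i _ _
    rw [bayesProj_uniform (by lia) i]
    exact ih _

theorem bayesProj_eq_one_of_eq_one {n : ℕ} {x : Fin (n + 1) → ℝ}
    (hx : IsClassicalState (n + 1) x) {i : Fin (n + 1)} {j : Fin n}
    (h : x (i.succAbove j) = 1) : bayesProj i x j = 1 := by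
  simp [bayesProj, h, hx.eq_zero_of_eq_one h (Fin.succAbove_ne i j).symm]

/-- Pure states are maximal in the Bayesian order. -/
theorem BayesLE.eq_one_of_eq_one (m : ℕ) {x y : Fin (m + 2) → ℝ}
    (hx : IsClassicalState (m + 2) x) (hy : IsClassicalState (m + 2) y) {i : Fin (m + 2)}
    (hxi : x i = 1) (hxy : BayesLE (m + 2) x y) : y i = 1 := by
  induction m with
  | zero =>
    have hsx := hx.2
    have hsy := hy.2
    rw [Fin.sum_univ_two] at hsx hsy
    have h0 := hy.1 0
    have h1 := hy.1 1
    simp only [Set.mem_Icc] at h0 h1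
    fin_cases i <;> simp only [Fin.zero_eta, Fin.mk_one] at hxi ⊢ <;>
      rcases hxy with h | h <;> linarith
  | succ m ih =>
    have key : ∀ k, k ≠ i → y k ≠ 1 → ∀ j, j ≠ k → j ≠ i → y j = 0 := by
      intro k hk hyk j hjk hji
      have hxk : x k ≠ 1 := by simp [hx.eq_zero_of_eq_one hxi hk]
      obtain ⟨i', rfl⟩ := Fin.exists_succAbove_eq hk.symm
      obtain ⟨j', rfl⟩ := Fin.exists_succAbove_eq hjk
      have hyp := hy.bayesProj hyk
      have h1 := ih (hx.bayesProj hxk) hyp (bayesProj_eq_one_of_eq_one hx hxi)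
        (hxy k hxk hyk)
      have h0 := hyp.eq_zero_of_eq_one h1 (fun h => hji (congrArg _ h))
      exact (mul_eq_zero.1 h0).resolve_left (inv_ne_zero (sub_ne_zero.2 hyk.symm))
    apply hy.eq_one_of_forall_eq_zero
    intro j hj
    obtain ⟨k, hki, hkj⟩ : ∃ k, k ≠ i ∧ k ≠ j := by
      simpa using Finset.exists_mem_notMem_of_card_lt_card (s := {i, j}) (t := Finset.univ)
        (lt_of_le_of_lt Finset.card_le_two (by simp))
    by_cases hyk : y k = 1
    · exact hy.eq_zero_of_eq_one hyk hkj.symm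
    · exact key k hki hyk j hkj.symm hj

theorem BayesLE.trans (m : ℕ) {x y z : Fin (m + 2) → ℝ} (hx : IsClassicalState (m + 2) x)
    (hy : IsClassicalState (m + 2) y) (hz : IsClassicalState (m + 2) z)
    (hxy : BayesLE (m + 2) x y) (hyz : BayesLE (m + 2) y z) : BayesLE (m + 2) x z := by
  induction m with
  | zero =>
    simp only [BayesLE] at *
    grind
  | succ m ih =>
    intro i hxi hzi
    have hyi : y i ≠ 1 := fun h => hzi (BayesLE.eq_one_of_eq_one _ hy hz h hyz)
    exact ih (hx.bayesProj hxi) (hy.bayesProj hyi) (hz.bayesProj hzi) (hxy i hxi hyi)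
      (hyz i hyi hzi)

/-- A vector with at least three coordinates is determined by its Bayesian projections. -/
theorem eq_of_forall_bayesProj_eq (m : ℕ) {x y : Fin (m + 3) → ℝ} (hx : ∀ i, x i ≠ 1)
    (hy : ∀ i, y i ≠ 1) (h : ∀ i, bayesProj i x = bayesProj i y) : x = y := by
  have cross : ∀ i j, j ≠ i → x j * (1 - y i) = y j * (1 - x i) := by
    intro i j hj
    obtain ⟨j, rfl⟩ := Fin.exists_succAbove_eq hj
    have hj := congrFun (h i) j
    have hxi := sub_ne_zero.2 (hx i).symm
    have hyi := sub_ne_zero.2 (hy i).symm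
    simp only [bayesProj] at hj
    field_simp at hj
    linarith
  have anti : ∀ i j, j ≠ i → x j - y j = -(x i - y i) := fun i j hj => by
    linarith [cross i j hj, cross j i hj.symm]
  funext i
  obtain ⟨j, k, hji, hki, hkj⟩ : ∃ j k, j ≠ i ∧ k ≠ i ∧ k ≠ j := by
    obtain ⟨j, hj⟩ := exists_ne i
    obtain ⟨k, hk⟩ := Finset.exists_mem_notMem_of_card_lt_card (s := {i, j}) (t := Finset.univ)
      (lt_of_le_of_lt Finset.card_le_two (by simp))
    exact ⟨j, k, hj, by simp_all⟩
  linarith [anti i j hji, anti i k hki, anti j k hkj]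

theorem BayesLE.antisymm (m : ℕ) {x y : Fin (m + 2) → ℝ} (hx : IsClassicalState (m + 2) x)
    (hy : IsClassicalState (m + 2) y) (hxy : BayesLE (m + 2) x y)
    (hyx : BayesLE (m + 2) y x) : x = y := by
  induction m with
  | zero =>
    have hsx := hx.2
    have hsy := hy.2
    rw [Fin.sum_univ_two] at hsx hsy
    have h0 : x 0 = y 0 := by
      rcases hxy with h | h <;> rcases hyx with h' | h' <;> linarith
    funext i
    fin_cases i
    · exact h0
    · change x 1 = y 1
      linarith
  | succ m ih =>
    by_cases h1 : ∃ i, x i = 1 ∨ y i = 1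
    · obtain ⟨i, hi | hi⟩ := h1
      · exact hx.ext_of_eq_one hy hi (BayesLE.eq_one_of_eq_one _ hx hy hi hxy)
      · exact hx.ext_of_eq_one hy (BayesLE.eq_one_of_eq_one _ hy hx hi hyx) hi
    · push Not at h1
      exact eq_of_forall_bayesProj_eq m (fun i => (h1 i).1) (fun i => (h1 i).2) fun i =>
        ih (hx.bayesProj (h1 i).1) (hy.bayesProj (h1 i).2) (hxy i (h1 i).1 (h1 i).2)
          (hyx i (h1 i).2 (h1 i).1)

/-- Every state lies below the pure state at any of its largest coordinates. -/
theorem bayesLE_of_forall_le (m : ℕ) {x y : Fin (m + 2) → ℝ} (hx : IsClassicalState (m + 2) x)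
    (hy : IsClassicalState (m + 2) y) {i : Fin (m + 2)} (hmax : ∀ j, x j ≤ x i)
    (hyi : y i = 1) : BayesLE (m + 2) x y := by
  induction m with
  | zero =>
    have hsx := hx.2
    have hsy := hy.2
    rw [Fin.sum_univ_two] at hsx hsy
    have h0 := hmax 0
    have h1 := hmax 1
    have hx0 := hx.1 0
    simp only [Set.mem_Icc] at hx0
    fin_cases i <;> simp only [Fin.zero_eta, Fin.mk_one] at *
    · exact Or.inr ⟨by linarith, by linarith⟩
    · exact Or.inl ⟨by linarith, by linarith⟩
  | succ m ih =>
    intro k hxk hyk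
    obtain ⟨i, rfl⟩ := Fin.exists_succAbove_eq (fun h : i = k => hyk (h ▸ hyi))
    refine ih (hx.bayesProj hxk) (hy.bayesProj hyk) (i := i) (fun j => ?_)
      (bayesProj_eq_one_of_eq_one hy hyi)
    exact mul_le_mul_of_nonneg_left (hmax _) (inv_nonneg.2 (sub_nonneg.2 (hx.1 k).2))

/-- For `n ≥ 2`, the Bayesian order on `Δⁿ` is a partial order; its least
element is the uniform distribution `(1/n, …, 1/n)`, and its maximal elements
are exactly the pure states `eᵢ`. -/
theorem bayesLE_partialOrder_least_max (n : ℕ) (hn : 2 ≤ n) :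
    (∀ x, IsClassicalState n x → BayesLE n x x) ∧
    (∀ x y z, IsClassicalState n x → IsClassicalState n y → IsClassicalState n z →
      BayesLE n x y → BayesLE n y z → BayesLE n x z) ∧
    (∀ x y, IsClassicalState n x → IsClassicalState n y →
      BayesLE n x y → BayesLE n y x → x = y) ∧
    (IsClassicalState n (fun _ => (n : ℝ)⁻¹) ∧
      ∀ x, IsClassicalState n x → BayesLE n (fun _ => (n : ℝ)⁻¹) x) ∧
    (∀ x, IsClassicalState n x →
      ((∀ y, IsClassicalState n y → BayesLE n x y → y = x) ↔ ∃ i, x i = 1)) := by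
  obtain ⟨m, rfl⟩ := Nat.exists_eq_add_of_le' hn
  refine ⟨fun x _ => bayesLE_refl m x, fun x y z hx hy hz => BayesLE.trans m hx hy hz,
    fun x y hx hy => BayesLE.antisymm m hx hy,
    ⟨isClassicalState_uniform (by lia), fun x _ => uniform_bayesLE m x⟩, fun x hx => ⟨?_, ?_⟩⟩
  · intro h
    obtain ⟨i, hi⟩ := Finite.exists_max x
    have hle : BayesLE (m + 2) x (Pi.single i 1) :=
      bayesLE_of_forall_le m hx (isClassicalState_single i) hi (Pi.single_eq_same i 1)
    exact ⟨i, by rw [← h _ (isClassicalState_single i) hle, Pi.single_eq_same]⟩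
  · rintro ⟨i, hi⟩ y hy hxy
    exact hy.ext_of_eq_one hx (BayesLE.eq_one_of_eq_one m hx hy hi hxy) hi
end

section
/- Every linear combinatory algebra yields a standard combinatory algebra: let (A, ·, !) be a linear combinatory algebra, define x ·ₛ y ≡ x·!y, D' ≡ C·(B·B·I)·(B·D·I), and set Bₛ ≡ C·(B·(B·B·B)·(D'·I))·(C·((B·B)·F)·δ), Cₛ ≡ D'·C, Iₛ ≡ D'·I, Kₛ ≡ D'·K, Wₛ ≡ D'·W. Then (A, ·ₛ) with these elements satisfies, for all x, y, z ∈ A: Bₛ·ₛx·ₛy·ₛz = x·ₛ(y·ₛz); Cₛ·ₛx·ₛy·ₛz = (x·ₛz)·ₛy; Iₛ·ₛx = x; Kₛ·ₛx·ₛy = x; Wₛ·ₛx·ₛy = x·ₛy·ₛy. -/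
/-- A linear combinatory algebra `(A, ·, !)`: an applicative structure with a
unary operation `!` and distinguished elements `B, C, I, K, D, δ, F, W`
satisfying the eight axioms of linear combinatory logic. -/
structure LCA (A : Type*) where
  app : A → A → A
  bang : A → A
  B : A
  C : A
  I : A
  K : A
  D : A
  δ : A
  F : A
  W : A
  hB : ∀ x y z, app (app (app B x) y) z = app x (app y z)
  hC : ∀ x y z, app (app (app C x) y) z = app (app x z) y
  hI : ∀ x, app I x = x
  hK : ∀ x y, app (app K x) (bang y) = x
  hD : ∀ x, app D (bang x) = x
  hδ : ∀ x, app δ (bang x) = bang (bang x)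
  hF : ∀ x y, app (app F (bang x)) (bang y) = bang (app x y)
  hW : ∀ x y, app (app W x) (bang y) = app (app x (bang y)) (bang y)

namespace LCA

variable {A : Type*} (L : LCA A)

/-- `D' ≡ C·(B·B·I)·(B·D·I)`. -/
def D' : A := L.app (L.app L.C (L.app (L.app L.B L.B) L.I)) (L.app (L.app L.B L.D) L.I)

/-- The induced "standard" application: `x ·ₛ y ≡ x·!y`. -/
def sapp (x y : A) : A := L.app x (L.bang y)

/-- `Bₛ ≡ C·(B·(B·B·B)·(D'·I))·(C·((B·B)·F)·δ)`. -/
def Bs : A :=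
  L.app
    (L.app L.C
      (L.app (L.app L.B (L.app (L.app L.B L.B) L.B)) (L.app L.D' L.I)))
    (L.app (L.app L.C (L.app (L.app L.B L.B) L.F)) L.δ)

/-- `Cₛ ≡ D'·C`. -/
def Cs : A := L.app L.D' L.C

/-- `Iₛ ≡ D'·I`. -/
def Is : A := L.app L.D' L.I

/-- `Kₛ ≡ D'·K`. -/
def Ks : A := L.app L.D' L.K

/-- `Wₛ ≡ D'·W`. -/
def Ws : A := L.app L.D' L.W

lemma D'_app_bang (x y : A) : L.app (L.app L.D' x) (L.bang y) = L.app x y := by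
  simp only [D', L.hB, L.hC, L.hI, L.hD]

/-- **Every linear combinatory algebra yields a standard combinatory algebra:**
the elements `Bₛ, Cₛ, Iₛ, Kₛ, Wₛ` satisfy the axioms of a standard combinatory
algebra for the application `x ·ₛ y ≡ x·!y`. -/
theorem standard_combinatory_algebra :
    (∀ x y z, L.sapp (L.sapp (L.sapp L.Bs x) y) z = L.sapp x (L.sapp y z)) ∧
    (∀ x y z, L.sapp (L.sapp (L.sapp L.Cs x) y) z = L.sapp (L.sapp x z) y) ∧
    (∀ x, L.sapp L.Is x = x) ∧
    (∀ x y, L.sapp (L.sapp L.Ks x) y = x) ∧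
    (∀ x y, L.sapp (L.sapp L.Ws x) y = L.sapp (L.sapp x y) y) := by
  simp only [sapp, Bs, Cs, Is, Ks, Ws, L.D'_app_bang, L.hB, L.hC, L.hI, L.hK, L.hδ, L.hF, L.hW,
    implies_true, and_self]

end LCA
end

section
/- Partial involutions are closed under the Geometry-of-Interaction application: if f and g are partial involutions on ℕ, then f • g is again a partial involution on ℕ. -/
/-- A partial involution on `ℕ`, as a relation: a partial injective function
that equals its own relational converse. -/
def PartialInvolution (f : ℕ → ℕ → Prop) : Prop :=
  (∀ x y z, f x y → f x z → y = z) ∧      -- functional (a partial function)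
  (∀ x y z, f x z → f y z → x = y) ∧      -- injective
  (∀ x y, f x y ↔ f y x)                  -- equal to its own converse

/-- The component `f_{ij}` of `f` conjugated by the splitting `s : ℕ ⊕ ℕ ≃ ℕ`:
the restriction of `s⁻¹ ∘ f ∘ s` mapping the `i`-th summand into the `j`-th
summand, as a relation on `ℕ`.  Here `inl` is the first summand and `inr` the
second. -/
def comp11 (s : ℕ ⊕ ℕ ≃ ℕ) (f : ℕ → ℕ → Prop) : ℕ → ℕ → Prop :=
  fun m k => f (s (Sum.inl m)) (s (Sum.inl k))

def comp12 (s : ℕ ⊕ ℕ ≃ ℕ) (f : ℕ → ℕ → Prop) : ℕ → ℕ → Prop :=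
  fun m k => f (s (Sum.inl m)) (s (Sum.inr k))

def comp21 (s : ℕ ⊕ ℕ ≃ ℕ) (f : ℕ → ℕ → Prop) : ℕ → ℕ → Prop :=
  fun m k => f (s (Sum.inr m)) (s (Sum.inl k))

def comp22 (s : ℕ ⊕ ℕ ≃ ℕ) (f : ℕ → ℕ → Prop) : ℕ → ℕ → Prop :=
  fun m k => f (s (Sum.inr m)) (s (Sum.inr k))

/-- Geometry-of-Interaction application:
`f • g = f₂₂ ∪ f₂₁ ; g ; (f₁₁ ; g)* ; f₁₂`
(relational composition `;`, reflexive-transitive closure `*`, union `∪`). -/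
def goiApp (s : ℕ ⊕ ℕ ≃ ℕ) (f g : ℕ → ℕ → Prop) : ℕ → ℕ → Prop :=
  fun m k =>
    comp22 s f m k ∨
    Relation.Comp (comp21 s f)
      (Relation.Comp g
        (Relation.Comp (Relation.ReflTransGen (Relation.Comp (comp11 s f) g))
          (comp12 s f))) m k

theorem exists_comp_reflTransGen_reverse {α : Type*} {p g : α → α → Prop}
    (hp : ∀ x y, p x y → p y x) (hg : ∀ x y, g x y → g y x) {a b c : α} (hab : g a b)
    (hbc : Relation.ReflTransGen (Relation.Comp p g) b c) :
    ∃ d, g c d ∧ Relation.ReflTransGen (Relation.Comp p g) d a := by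
  induction hbc with
  | refl => exact ⟨a, hg _ _ hab, .refl⟩
  | tail _ h ih =>
    obtain ⟨d, hd, hda⟩ := ih
    obtain ⟨e, hce, hec⟩ := h
    exact ⟨e, hg _ _ hec, .head ⟨_, hp _ _ hce, hd⟩ hda⟩

theorem reflTransGen_comp_exit_unique {α β : Type*} {p g : α → α → Prop} {q : α → β → Prop}
    (hp : ∀ x y z, p x y → p x z → y = z) (hg : ∀ x y z, g x y → g x z → y = z)
    (hq : ∀ x y z, q x y → q x z → y = z) (hpq : ∀ x y z, p x y → ¬ q x z)
    {a c c' : α} {k k' : β}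
    (h : Relation.ReflTransGen (Relation.Comp p g) a c) (hk : q c k)
    (h' : Relation.ReflTransGen (Relation.Comp p g) a c') (hk' : q c' k') : k = k' := by
  induction h using Relation.ReflTransGen.head_induction_on with
  | refl =>
    rcases h'.cases_head with rfl | ⟨_, ⟨_, hpc, _⟩, _⟩
    · exact hq _ _ _ hk hk'
    · exact absurd hk (hpq _ _ _ hpc)
  | head hstep _ ih =>
    obtain ⟨u, hu, hv⟩ := hstep
    rcases h'.cases_head with rfl | ⟨_, ⟨u', hu', hv'⟩, hrest⟩
    · exact absurd hk' (hpq _ _ _ hu)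
    · obtain rfl := hp _ _ _ hu hu'
      obtain rfl := hg _ _ _ hv hv'
      exact ih hrest

theorem goiApp_symm (s : ℕ ⊕ ℕ ≃ ℕ) {f g : ℕ → ℕ → Prop}
    (hf : ∀ x y, f x y → f y x) (hg : ∀ x y, g x y → g y x) {x y : ℕ}
    (h : goiApp s f g x y) : goiApp s f g y x := by
  rcases h with h | ⟨a, hxa, b, hab, c, hbc, hcy⟩
  · exact Or.inl (hf _ _ h)
  · obtain ⟨d, hcd, hda⟩ := exists_comp_reflTransGen_reverse
      (p := comp11 s f) (fun _ _ h => hf _ _ h) hg hab hbc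
    exact Or.inr ⟨c, hf _ _ hcy, d, hcd, a, hda, hf _ _ hxa⟩

theorem goiApp_functional (s : ℕ ⊕ ℕ ≃ ℕ) {f g : ℕ → ℕ → Prop}
    (hf : ∀ x y z, f x y → f x z → y = z) (hg : ∀ x y z, g x y → g x z → y = z)
    {x y z : ℕ} (hy : goiApp s f g x y) (hz : goiApp s f g x z) : y = z := by
  have hl {w m n} (h : f w (s (.inl m))) (h' : f w (s (.inl n))) : m = n :=
    Sum.inl_injective (s.injective (hf _ _ _ h h'))
  have hr {w m n} (h : f w (s (.inr m))) (h' : f w (s (.inr n))) : m = n :=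
    Sum.inr_injective (s.injective (hf _ _ _ h h'))
  have hlr {w m n} (h : f w (s (.inl m))) : ¬ f w (s (.inr n)) := fun h' =>
    Sum.inl_ne_inr (s.injective (hf _ _ _ h h'))
  rcases hy with hy | ⟨a, hxa, b, hab, c, hbc, hcy⟩ <;>
    rcases hz with hz | ⟨a', hxa', b', hab', c', hbc', hcz⟩
  · exact hr hy hz
  · exact absurd hy (hlr hxa')
  · exact absurd hz (hlr hxa)
  · obtain rfl := hl hxa hxa'
    obtain rfl := hg _ _ _ hab hab'
    exact reflTransGen_comp_exit_unique (p := comp11 s f) (q := comp12 s f)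
      (fun _ _ _ => hl) hg (fun _ _ _ => hr) (fun _ _ _ => hlr) hbc hcy hbc' hcz

/-- **Partial involutions are closed under GoI application:** if `f` and `g`
are partial involutions on `ℕ`, so is `f • g`. -/
theorem goiApp_partialInvolution (s : ℕ ⊕ ℕ ≃ ℕ) (f g : ℕ → ℕ → Prop)
    (hf : PartialInvolution f) (hg : PartialInvolution g) :
    PartialInvolution (goiApp s f g) := by
  obtain ⟨hf_fun, -, hf_symm⟩ := hf
  obtain ⟨hg_fun, -, hg_symm⟩ := hg
  have symm {x y} : goiApp s f g x y → goiApp s f g y x :=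
    goiApp_symm s (fun _ _ => (hf_symm _ _).1) (fun _ _ => (hg_symm _ _).1)
  exact ⟨fun _ _ _ => goiApp_functional s hf_fun hg_fun,
    fun _ _ _ h h' => goiApp_functional s hf_fun hg_fun (symm h) (symm h'),
    fun _ _ => ⟨symm, symm⟩⟩
end

section
/- The twist involution acts as the identity combinator under Geometry-of-Interaction application: let tw be the total involution on ℕ given by tw = s ∘ σ ∘ s⁻¹, where σ : ℕ ⊕ ℕ → ℕ ⊕ ℕ is the map exchanging the two summands (σ(inl n) = inr n, σ(inr n) = inl n). Then tw is a fixed-point-free partial involution on ℕ, and tw • x = x for every partial involution x on ℕ. -/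
/-- The twist involution `tw = s ∘ σ ∘ s⁻¹` (as a relation on `ℕ`), where
`σ : ℕ ⊕ ℕ → ℕ ⊕ ℕ` exchanges the two summands. -/
def twist (s : ℕ ⊕ ℕ ≃ ℕ) : ℕ → ℕ → Prop :=
  fun x y => y = s (Sum.swap (s.symm x))

theorem twist_symm (s : ℕ ⊕ ℕ ≃ ℕ) (x y : ℕ) : twist s x y ↔ twist s y x := by
  constructor <;> rintro rfl <;> simp [twist]

theorem comp11_twist (s : ℕ ⊕ ℕ ≃ ℕ) : comp11 s (twist s) = fun _ _ => False := by
  ext m k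
  simp [comp11, twist]

theorem comp12_twist (s : ℕ ⊕ ℕ ≃ ℕ) : comp12 s (twist s) = Eq := by
  ext m k
  simp [comp12, twist, eq_comm]

theorem comp21_twist (s : ℕ ⊕ ℕ ≃ ℕ) : comp21 s (twist s) = Eq := by
  ext m k
  simp [comp21, twist, eq_comm]

theorem comp22_twist (s : ℕ ⊕ ℕ ≃ ℕ) : comp22 s (twist s) = fun _ _ => False := by
  ext m k
  simp [comp22, twist]

/-- Applying the twist to any relation returns that relation. -/
theorem goiApp_twist (s : ℕ ⊕ ℕ ≃ ℕ) (g : ℕ → ℕ → Prop) : goiApp s (twist s) g = g := by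
  have loop : Relation.ReflTransGen (Relation.Comp (fun _ _ => False) g) = Eq := by
    ext a b
    constructor
    · intro h
      induction h with
      | refl => rfl
      | tail _ h _ =>
        obtain ⟨_, h, _⟩ := h
        exact h.elim
    · rintro rfl
      exact .refl
  ext m k
  simp only [goiApp, comp11_twist, comp12_twist, comp21_twist, comp22_twist, loop,
    Relation.comp_eq, Relation.eq_comp, false_or]

/-- **The twist acts as the identity combinator:** `tw` is a fixed-point-free
partial involution, and `tw • x = x` for every partial involution `x`. -/
theorem twist_identity (s : ℕ ⊕ ℕ ≃ ℕ) :
    PartialInvolution (twist s) ∧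
    (∀ m k, twist s m k → m ≠ k) ∧
    (∀ x : ℕ → ℕ → Prop, PartialInvolution x →
      ∀ m k, goiApp s (twist s) x m k ↔ x m k) := by
  refine ⟨⟨?_, ?_, ?_⟩, ?_, ?_⟩
  · rintro x y z rfl rfl
    rfl
  · intro x y z hx hy
    rw [← twist_symm] at hx hy
    exact hx.trans hy.symm
  · exact twist_symm s
  · rintro m k h rfl
    have h' : s.symm m = (s.symm m).swap := s.symm_apply_eq.mpr h
    rcases hm : s.symm m with a | a <;> simp [hm] at h'
  · intro x _ m k
    rw [goiApp_twist]
end
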